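/- arXiv:gr-qc/9508065 — 2 statements merged into one kernel-verified Lean document; each statement's English description precedes it below -/
import Mathlib

section
/- Let m = 1 and let α, β, ρ be real numbers with α² + β² ≠ 0 and αβ sin ρ = 0. Then the bifurcation system (B) for the (1:1) resonance has a nonzero finite number of solutions (e, ℓ, g) ∈ (0,1) × [0,2π) × [0,2π), and every solution is simple. -/
open Real Set

/-- Bessel function of integer order `n`. -/
noncomputable def besselJ (n : ℤ) (x : ℝ) : ℝ :=
  (1 / (2 * π)) * ∫ t in (0:ℝ)..(2 * π), Real.cos (n * t - x * Real.sin t)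

/-- Derivative of the Bessel function with respect to its argument. -/
noncomputable def besselJd (n : ℤ) (x : ℝ) : ℝ := deriv (besselJ n) x

/-- The Fourier coefficient `A_m(e)`. -/
noncomputable def coefA (m : ℕ) (e : ℝ) : ℝ :=
  (4 / ((m:ℝ) ^ 2 * e ^ 2)) *
    (2 * m * e * (1 - e ^ 2) * besselJd m (m * e) - (2 - e ^ 2) * besselJ m (m * e))

/-- The Fourier coefficient `B_m(e)`. -/
noncomputable def coefB (m : ℕ) (e : ℝ) : ℝ :=
  -(8 / ((m:ℝ) ^ 2 * e ^ 2)) * Real.sqrt (1 - e ^ 2) *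
    (e * besselJd m (m * e) - m * (1 - e ^ 2) * besselJ m (m * e))

/-- `𝓔 = √(α²+β²+2αβ sin ρ)`. -/
noncomputable def calE (α β ρ : ℝ) : ℝ := Real.sqrt (α ^ 2 + β ^ 2 + 2 * α * β * Real.sin ρ)

/-- `𝓕 = √(α²+β²−2αβ sin ρ)`. -/
noncomputable def calF (α β ρ : ℝ) : ℝ := Real.sqrt (α ^ 2 + β ^ 2 - 2 * α * β * Real.sin ρ)

/-- First equation of the bifurcation system (B): `𝓕(A_m+B_m)cos(2g+mℓ+τ)`. -/
noncomputable def bifF1 (m : ℕ) (α β ρ τ : ℝ) (e ℓ g : ℝ) : ℝ :=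
  calF α β ρ * (coefA m e + coefB m e) * Real.cos (2 * g + m * ℓ + τ)

/-- Second equation of the bifurcation system (B): `𝓔(A_m−B_m)cos(2g−mℓ+σ)`. -/
noncomputable def bifF2 (m : ℕ) (α β ρ σ : ℝ) (e ℓ g : ℝ) : ℝ :=
  calE α β ρ * (coefA m e - coefB m e) * Real.cos (2 * g - m * ℓ + σ)

/-- Third equation of the bifurcation system (B):
`(A_m'+B_m')𝓕 sin(2g+mℓ+τ) + (A_m'−B_m')𝓔 sin(2g−mℓ+σ)`. -/
noncomputable def bifF3 (m : ℕ) (α β ρ σ τ : ℝ) (e ℓ g : ℝ) : ℝ :=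
  (deriv (coefA m) e + deriv (coefB m) e) * calF α β ρ * Real.sin (2 * g + m * ℓ + τ) +
  (deriv (coefA m) e - deriv (coefB m) e) * calE α β ρ * Real.sin (2 * g - m * ℓ + σ)

/-- The solution set of the bifurcation system (B) for the `(m:1)` resonance, in the
unknowns `(e, ℓ, g) ∈ (0,1) × [0,2π) × [0,2π)`. -/
noncomputable def bifSolSet (m : ℕ) (α β ρ σ τ : ℝ) : Set (ℝ × ℝ × ℝ) :=
  {p | p.1 ∈ Set.Ioo (0:ℝ) 1 ∧ p.2.1 ∈ Set.Ico (0:ℝ) (2 * π) ∧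
       p.2.2 ∈ Set.Ico (0:ℝ) (2 * π) ∧
       bifF1 m α β ρ τ p.1 p.2.1 p.2.2 = 0 ∧
       bifF2 m α β ρ σ p.1 p.2.1 p.2.2 = 0 ∧
       bifF3 m α β ρ σ τ p.1 p.2.1 p.2.2 = 0}

/-- Jacobian determinant of the three left-hand sides of system (B) with respect to
`(e, ℓ, g)`; a solution is simple when this is nonzero. -/
noncomputable def bifJac (m : ℕ) (α β ρ σ τ : ℝ) (e ℓ g : ℝ) : ℝ :=
  Matrix.det
    !![deriv (fun x => bifF1 m α β ρ τ x ℓ g) e,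
       deriv (fun x => bifF1 m α β ρ τ e x g) ℓ,
       deriv (fun x => bifF1 m α β ρ τ e ℓ x) g;
       deriv (fun x => bifF2 m α β ρ σ x ℓ g) e,
       deriv (fun x => bifF2 m α β ρ σ e x g) ℓ,
       deriv (fun x => bifF2 m α β ρ σ e ℓ x) g;
       deriv (fun x => bifF3 m α β ρ σ τ x ℓ g) e,
       deriv (fun x => bifF3 m α β ρ σ τ e x g) ℓ,
       deriv (fun x => bifF3 m α β ρ σ τ e ℓ x) g]


noncomputable def Ks (n : ℕ) (x : ℝ) : ℝ :=
  (1 / (2 * π)) * ∫ t in (0:ℝ)..(2 * π), Real.sin t ^ n * Real.sin (x * Real.sin t)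

noncomputable def Kc (n : ℕ) (x : ℝ) : ℝ :=
  (1 / (2 * π)) * ∫ t in (0:ℝ)..(2 * π), Real.sin t ^ n * Real.cos (x * Real.sin t)

lemma sin_pow_abs_le (n : ℕ) (t : ℝ) : |Real.sin t ^ n| ≤ 1 := by
  rw [abs_pow]
  exact pow_le_one₀ (abs_nonneg _) (Real.abs_sin_le_one t)

lemma hasDeriv_Ks (n : ℕ) (x : ℝ) : HasDerivAt (Ks n) (Kc (n+1) x) x := by
  unfold Ks Kc
  apply HasDerivAt.const_mul
  refine (intervalIntegral.hasDerivAt_integral_of_dominated_loc_of_deriv_le (μ := MeasureTheory.volume)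
    (F := fun x t => Real.sin t ^ n * Real.sin (x * Real.sin t))
    (F' := fun x t => Real.sin t ^ (n+1) * Real.cos (x * Real.sin t))
    (bound := fun _ => 1) (s := Set.univ) Filter.univ_mem ?_ ?_ ?_ ?_ ?_ ?_).2
  · refine Filter.Eventually.of_forall fun y => Continuous.aestronglyMeasurable ?_
    fun_prop
  · apply Continuous.intervalIntegrable; fun_prop
  · apply Continuous.aestronglyMeasurable; fun_prop
  · refine Filter.Eventually.of_forall fun t _ y _ => ?_
    rw [Real.norm_eq_abs, abs_mul]
    exact mul_le_one₀ (sin_pow_abs_le _ _) (abs_nonneg _) (Real.abs_cos_le_one _)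
  · simp
  · refine Filter.Eventually.of_forall fun t _ y _ => ?_
    have h := ((hasDerivAt_id y).mul_const (Real.sin t)).sin.const_mul (Real.sin t ^ n)
    refine h.congr_deriv ?_
    simp only [id]; ring

lemma hasDeriv_Kc (n : ℕ) (x : ℝ) : HasDerivAt (Kc n) (-Ks (n+1) x) x := by
  unfold Ks Kc
  rw [← mul_neg, ← intervalIntegral.integral_neg]
  apply HasDerivAt.const_mul
  refine (intervalIntegral.hasDerivAt_integral_of_dominated_loc_of_deriv_le (μ := MeasureTheory.volume)
    (F := fun x t => Real.sin t ^ n * Real.cos (x * Real.sin t))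
    (F' := fun x t => -(Real.sin t ^ (n+1) * Real.sin (x * Real.sin t)))
    (bound := fun _ => 1) (s := Set.univ) Filter.univ_mem ?_ ?_ ?_ ?_ ?_ ?_).2
  · refine Filter.Eventually.of_forall fun y => Continuous.aestronglyMeasurable ?_
    fun_prop
  · apply Continuous.intervalIntegrable; fun_prop
  · apply Continuous.aestronglyMeasurable; fun_prop
  · refine Filter.Eventually.of_forall fun t _ y _ => ?_
    rw [Real.norm_eq_abs, abs_neg, abs_mul]
    exact mul_le_one₀ (sin_pow_abs_le _ _) (abs_nonneg _) (Real.abs_sin_le_one _)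
  · simp
  · refine Filter.Eventually.of_forall fun t _ y _ => ?_
    have h := ((hasDerivAt_id y).mul_const (Real.sin t)).cos.const_mul (Real.sin t ^ n)
    refine h.congr_deriv ?_
    simp only [id]; ring

lemma besselJ_one : besselJ 1 = Ks 1 := by
  funext x
  unfold besselJ Ks
  congr 1
  have h1 : ∫ t in (0:ℝ)..(2 * π), Real.cos (x * Real.sin t) * Real.cos t = 0 := by
    have := intervalIntegral.integral_comp_mul_deriv (a := 0) (b := 2 * π)
      (f := Real.sin) (f' := Real.cos) (g := fun u => Real.cos (x * u))
      (fun t _ => Real.hasDerivAt_sin t) (by fun_prop) (by fun_prop)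
    simpa using this
  have h2 : ∀ t, Real.cos (((1:ℤ):ℝ) * t - x * Real.sin t) =
      Real.cos (x * Real.sin t) * Real.cos t + Real.sin t ^ 1 * Real.sin (x * Real.sin t) := by
    intro t; rw [Real.cos_sub]; simp; ring
  simp_rw [h2]
  rw [intervalIntegral.integral_add, h1, zero_add]
  all_goals { apply Continuous.intervalIntegrable; fun_prop }

lemma besselJd_one (x : ℝ) : besselJd 1 x = Kc 2 x := by
  unfold besselJd; rw [besselJ_one]; exact (hasDeriv_Ks 1 x).deriv

lemma key_id (e : ℝ) : e * Kc 2 e - Ks 1 e + e ^ 2 * Ks 1 e - e ^ 2 * Ks 3 e = 0 := by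
  have h := intervalIntegral.integral_eq_sub_of_hasDerivAt (a := 0) (b := 2 * π)
    (f := fun t => Real.cos t * Real.sin (e * Real.sin t)
      - e * (Real.sin t * Real.cos t * Real.cos (e * Real.sin t)))
    (f' := fun t => e * (Real.sin t ^ 2 * Real.cos (e * Real.sin t))
      - Real.sin t ^ 1 * Real.sin (e * Real.sin t)
      + e ^ 2 * (Real.sin t ^ 1 * Real.sin (e * Real.sin t))
      - e ^ 2 * (Real.sin t ^ 3 * Real.sin (e * Real.sin t)))
    (fun t _ => by
      have hs := (Real.hasDerivAt_sin t).const_mul e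
      have h1 := (Real.hasDerivAt_cos t).mul hs.sin
      have h2 := (((Real.hasDerivAt_sin t).mul (Real.hasDerivAt_cos t)).mul hs.cos).const_mul e
      refine (h1.sub h2).congr_deriv ?_
      have := Real.cos_sq' t
      simp only [Pi.mul_apply]
      linear_combination (e ^ 2 * Real.sin t * Real.sin (e * Real.sin t)) * this)
    (by apply Continuous.intervalIntegrable; fun_prop)
  rw [intervalIntegral.integral_sub, intervalIntegral.integral_add, intervalIntegral.integral_sub] at h
  · simp only [intervalIntegral.integral_const_mul] at h
    simp only [Real.sin_two_pi, Real.sin_zero, mul_zero, zero_mul, sub_zero] at h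
    unfold Ks Kc
    linear_combination (1 / (2 * π)) * h
  all_goals { apply Continuous.intervalIntegrable; fun_prop }

lemma Ks_zero (n : ℕ) : Ks n 0 = 0 := by simp [Ks]

lemma coefA_eq : coefA 1 = fun e => -4 * Ks 1 e + 8 * Ks 3 e - 8 * (e * Kc 2 e) := by
  funext e
  unfold coefA
  simp only [Nat.cast_one, one_mul, one_pow, mul_one, besselJd_one, besselJ_one]
  rcases eq_or_ne e 0 with rfl | he
  · simp [Ks_zero]
  · have := key_id e
    field_simp
    linear_combination 8 * this

lemma coefB_eq : coefB 1 = fun e => -8 * (Real.sqrt (1 - e ^ 2) * Ks 3 e) := by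
  funext e
  unfold coefB
  simp only [Nat.cast_one, one_mul, one_pow, mul_one, besselJd_one, besselJ_one]
  rcases eq_or_ne e 0 with rfl | he
  · simp [Ks_zero]
  · have := key_id e
    field_simp
    linear_combination (-Real.sqrt (1 - e ^ 2)) * this

/-- averaged sin powers -/
lemma sin_int_rec (n : ℕ) : ∫ t in (0:ℝ)..(2 * π), Real.sin t ^ (n+2) =
    (n + 1) / (n + 2) * ∫ t in (0:ℝ)..(2 * π), Real.sin t ^ n := by
  rw [integral_sin_pow]; simp

lemma sin_int_two : ∫ t in (0:ℝ)..(2 * π), Real.sin t ^ 2 = π := by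
  have := sin_int_rec 0
  simp at this; simp [this]

lemma sin_int_four : ∫ t in (0:ℝ)..(2 * π), Real.sin t ^ 4 = 3 / 4 * π := by
  have := sin_int_rec 2
  rw [sin_int_two] at this; norm_num at this; simp [this]

lemma sin_int_six : ∫ t in (0:ℝ)..(2 * π), Real.sin t ^ 6 = 5 / 8 * π := by
  have := sin_int_rec 4
  rw [sin_int_four] at this; norm_num at this; rw [this]; ring

lemma avg_mono {f g : ℝ → ℝ} (hf : Continuous f) (hg : Continuous g) (h : ∀ t, f t ≤ g t) :
    (1 / (2 * π)) * ∫ t in (0:ℝ)..(2 * π), f t ≤ (1 / (2 * π)) * ∫ t in (0:ℝ)..(2 * π), g t := by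
  apply mul_le_mul_of_nonneg_left _ (by positivity)
  exact intervalIntegral.integral_mono (by positivity) (hf.intervalIntegrable _ _)
    (hg.intervalIntegrable _ _) h

/-- pointwise bounds, odd in θ -/
lemma mul_sin_lower {s e : ℝ} (hs : |s| ≤ 1) (he : 0 < e) (he1 : e ≤ 1) :
    e * s ^ 2 - e ^ 3 / 4 * s ^ 4 ≤ s * Real.sin (e * s) := by
  have key : ∀ u : ℝ, 0 ≤ u → u ≤ 1 → e * u ^ 2 - e ^ 3 / 4 * u ^ 4 ≤ u * Real.sin (e * u) := by
    intro u hu hu1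
    rcases hu.eq_or_lt with rfl | hu
    · simp
    · have h1 := Real.sin_gt_sub_cube (mul_pos he hu)
      have h3 : 0 ≤ (e * u) ^ 3 := by positivity
      have h5 : e * u - (e * u) ^ 3 / 4 ≤ Real.sin (e * u) := by linarith
      have := mul_le_mul_of_nonneg_left h5 hu.le
      linarith
  have := key |s| (abs_nonneg _) hs
  rw [sq_abs, show |s| ^ 4 = s ^ 4 by rw [← abs_pow]; exact abs_of_nonneg (by positivity)] at this
  rcases abs_cases s with h | h <;> rw [h.1] at this
  · exact this
  · simpa using this

lemma mul_sin_upper {s e : ℝ} (hs : |s| ≤ 1) (he : 0 < e) (he1 : e ≤ 1) :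
    s * Real.sin (e * s) ≤ e * s ^ 2 - e ^ 3 / 10 * s ^ 4 := by
  have key : ∀ u : ℝ, 0 ≤ u → u ≤ 1 → u * Real.sin (e * u) ≤ e * u ^ 2 - e ^ 3 / 10 * u ^ 4 := by
    intro u hu hu1
    have h0 : 0 ≤ e * u := by positivity
    have h1 : e * u ≤ 1 := by nlinarith
    have := Real.sin_bound (x := e * u) (by rwa [abs_of_nonneg h0])
    rw [abs_of_nonneg h0] at this
    have := (abs_le.1 this).2
    have h4 : (e * u) ^ 5 ≤ (e * u) ^ 3 := pow_le_pow_of_le_one h0 h1 (by norm_num)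
    have h3 : 0 ≤ (e * u) ^ 3 := by positivity
    have h5 : Real.sin (e * u) ≤ e * u - (e * u) ^ 3 / 10 := by linarith
    have := mul_le_mul_of_nonneg_left h5 hu
    linarith
  have := key |s| (abs_nonneg _) hs
  rw [sq_abs, show |s| ^ 4 = s ^ 4 by rw [← abs_pow]; exact abs_of_nonneg (by positivity)] at this
  rcases abs_cases s with h | h <;> rw [h.1] at this
  · exact this
  · simpa using this

lemma mul_sin_nonneg {s e : ℝ} (hs : |s| ≤ 1) (he : 0 < e) (he1 : e ≤ 1) :
    0 ≤ s * Real.sin (e * s) := by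
  refine le_trans ?_ (mul_sin_lower hs he he1)
  have : s ^ 2 ≤ 1 := by rw [← sq_abs]; exact pow_le_one₀ (abs_nonneg _) hs
  have h2 : e ^ 2 ≤ 1 := pow_le_one₀ he.le he1
  have : s ^ 2 * e ^ 2 ≤ 1 := mul_le_one₀ this (by positivity) h2
  have h3 : 0 ≤ e * s ^ 2 := by positivity
  nlinarith

lemma int_poly (a b : ℝ) (i j : ℕ) : ∫ t in (0:ℝ)..(2 * π), (a * Real.sin t ^ i - b * Real.sin t ^ j)
    = a * (∫ t in (0:ℝ)..(2 * π), Real.sin t ^ i) - b * (∫ t in (0:ℝ)..(2 * π), Real.sin t ^ j) := by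
  rw [intervalIntegral.integral_sub, intervalIntegral.integral_const_mul,
    intervalIntegral.integral_const_mul]
  all_goals { apply Continuous.intervalIntegrable; fun_prop }

lemma Ks1_lower {e : ℝ} (he : 0 < e) (he1 : e ≤ 1) : e / 2 - 3 / 32 * e ^ 3 ≤ Ks 1 e := by
  have := avg_mono (f := fun t => e * Real.sin t ^ 2 - e ^ 3 / 4 * Real.sin t ^ 4)
    (g := fun t => Real.sin t ^ 1 * Real.sin (e * Real.sin t)) (by fun_prop) (by fun_prop)
    (fun t => by
      have := mul_sin_lower (Real.abs_sin_le_one t) he he1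
      simpa using this)
  rw [int_poly, sin_int_two, sin_int_four] at this
  refine le_trans (le_of_eq ?_) this
  field_simp; ring

lemma Ks3_lower {e : ℝ} (he : 0 < e) (he1 : e ≤ 1) : 3 * e / 8 - 5 / 64 * e ^ 3 ≤ Ks 3 e := by
  have := avg_mono (f := fun t => e * Real.sin t ^ 4 - e ^ 3 / 4 * Real.sin t ^ 6)
    (g := fun t => Real.sin t ^ 3 * Real.sin (e * Real.sin t)) (by fun_prop) (by fun_prop)
    (fun t => by
      have := mul_le_mul_of_nonneg_left (mul_sin_lower (Real.abs_sin_le_one t) he he1)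
        (sq_nonneg (Real.sin t))
      linarith)
  rw [int_poly, sin_int_six, sin_int_four] at this
  refine le_trans (le_of_eq ?_) this
  field_simp; ring

lemma Ks3_upper {e : ℝ} (he : 0 < e) (he1 : e ≤ 1) : Ks 3 e ≤ 3 * e / 8 - 1 / 32 * e ^ 3 := by
  have := avg_mono (g := fun t => e * Real.sin t ^ 4 - e ^ 3 / 10 * Real.sin t ^ 6)
    (f := fun t => Real.sin t ^ 3 * Real.sin (e * Real.sin t)) (by fun_prop) (by fun_prop)
    (fun t => by
      have := mul_le_mul_of_nonneg_left (mul_sin_upper (Real.abs_sin_le_one t) he he1)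
        (sq_nonneg (Real.sin t))
      linarith)
  rw [int_poly, sin_int_six, sin_int_four] at this
  refine le_trans this (le_of_eq ?_)
  field_simp; ring

lemma Kc2_lower (e : ℝ) : 1 / 2 - 3 / 16 * e ^ 2 ≤ Kc 2 e := by
  have := avg_mono (f := fun t => 1 * Real.sin t ^ 2 - e ^ 2 / 2 * Real.sin t ^ 4)
    (g := fun t => Real.sin t ^ 2 * Real.cos (e * Real.sin t)) (by fun_prop) (by fun_prop)
    (fun t => by
      have := mul_le_mul_of_nonneg_left (Real.one_sub_sq_div_two_le_cos (x := e * Real.sin t))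
        (sq_nonneg (Real.sin t))
      linarith)
  rw [int_poly, sin_int_two, sin_int_four] at this
  refine le_trans (le_of_eq ?_) this
  field_simp; ring

lemma Kc4_lower (e : ℝ) : 3 / 8 - 5 / 32 * e ^ 2 ≤ Kc 4 e := by
  have := avg_mono (f := fun t => 1 * Real.sin t ^ 4 - e ^ 2 / 2 * Real.sin t ^ 6)
    (g := fun t => Real.sin t ^ 4 * Real.cos (e * Real.sin t)) (by fun_prop) (by fun_prop)
    (fun t => by
      have := mul_le_mul_of_nonneg_left (Real.one_sub_sq_div_two_le_cos (x := e * Real.sin t))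
        (show 0 ≤ Real.sin t ^ 4 by positivity)
      linarith)
  rw [int_poly, sin_int_six, sin_int_four] at this
  refine le_trans (le_of_eq ?_) this
  field_simp; ring

lemma Ks5_nonneg {e : ℝ} (he : 0 < e) (he1 : e ≤ 1) : 0 ≤ Ks 5 e := by
  have := avg_mono (f := fun t => 0)
    (g := fun t => Real.sin t ^ 5 * Real.sin (e * Real.sin t)) (by fun_prop) (by fun_prop)
    (fun t => by
      have := mul_nonneg (show 0 ≤ Real.sin t ^ 4 by positivity)
        (mul_sin_nonneg (Real.abs_sin_le_one t) he he1)
      linarith)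
  simpa [Ks] using this

lemma Ks5_le {e : ℝ} (he : 0 < e) (he1 : e ≤ 1) : Ks 5 e ≤ Ks 3 e :=
  avg_mono (by fun_prop) (by fun_prop) (fun t => by
      have := mul_nonneg (show 0 ≤ Real.sin t ^ 2 * (1 - Real.sin t ^ 2) from
        mul_nonneg (sq_nonneg _) (by nlinarith [Real.sin_sq_le_one t]))
        (mul_sin_nonneg (Real.abs_sin_le_one t) he he1)
      linarith)

noncomputable def A1 (e : ℝ) : ℝ := -12 * Kc 2 e + 8 * Kc 4 e + 8 * (e * Ks 3 e)
noncomputable def A2 (e : ℝ) : ℝ := 20 * Ks 3 e - 8 * Ks 5 e + 8 * (e * Kc 4 e)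
noncomputable def B1 (e : ℝ) : ℝ :=
  -8 * ((-e / Real.sqrt (1 - e ^ 2)) * Ks 3 e + Real.sqrt (1 - e ^ 2) * Kc 4 e)
noncomputable def B2 (e : ℝ) : ℝ :=
  8 * (Ks 3 e / Real.sqrt (1 - e ^ 2) ^ 3 + 2 * e / Real.sqrt (1 - e ^ 2) * Kc 4 e
    + Real.sqrt (1 - e ^ 2) * Ks 5 e)

lemma hasDeriv_A (e : ℝ) : HasDerivAt (coefA 1) (A1 e) e := by
  rw [coefA_eq]
  have := (((hasDeriv_Ks 1 e).const_mul (-4)).add ((hasDeriv_Ks 3 e).const_mul 8)).sub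
    (((hasDerivAt_id e).mul (hasDeriv_Kc 2 e)).const_mul 8)
  refine this.congr_deriv ?_
  simp only [A1, id]; ring

lemma deriv_A : deriv (coefA 1) = A1 := funext fun e => (hasDeriv_A e).deriv

lemma hasDeriv_A1 (e : ℝ) : HasDerivAt A1 (A2 e) e := by
  have := (((hasDeriv_Kc 2 e).const_mul (-12)).add ((hasDeriv_Kc 4 e).const_mul 8)).add
    (((hasDerivAt_id e).mul (hasDeriv_Ks 3 e)).const_mul 8)
  refine this.congr_deriv ?_
  simp only [A2, id]; ring

lemma hasDeriv_sqrt {e : ℝ} (he : 0 < 1 - e ^ 2) :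
    HasDerivAt (fun x => Real.sqrt (1 - x ^ 2)) (-e / Real.sqrt (1 - e ^ 2)) e := by
  have h := ((((hasDerivAt_id e).pow 2).const_sub 1).sqrt (by simpa using he.ne'))
  refine h.congr_deriv ?_
  simp
  field_simp

lemma hasDeriv_B {e : ℝ} (he : 0 < 1 - e ^ 2) : HasDerivAt (coefB 1) (B1 e) e := by
  rw [coefB_eq]
  exact ((hasDeriv_sqrt he).mul (hasDeriv_Ks 3 e)).const_mul (-8)

lemma hasDeriv_B1 {e : ℝ} (he : 0 < 1 - e ^ 2) : HasDerivAt B1 (B2 e) e := by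
  have hs : Real.sqrt (1 - e ^ 2) ≠ 0 := (Real.sqrt_pos.2 he).ne'
  have h1 := ((hasDerivAt_id e).neg.div (hasDeriv_sqrt he) hs).mul (hasDeriv_Ks 3 e)
  have := (h1.add ((hasDeriv_sqrt he).mul (hasDeriv_Kc 4 e))).const_mul (-8)
  refine this.congr_deriv ?_
  have h2 : Real.sqrt (1 - e ^ 2) ^ 2 = 1 - e ^ 2 := Real.sq_sqrt he.le
  simp only [B2, id, Pi.div_apply, Pi.neg_apply]
  field_simp
  have h4 : Real.sqrt (1 - e ^ 2) ^ 4 = (1 - e ^ 2) ^ 2 := by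
    rw [show 4 = 2 * 2 by norm_num, pow_mul, h2]
  rw [h4, h2]; ring

lemma hasDeriv_dB {e : ℝ} (he : 0 < 1 - e ^ 2) : HasDerivAt (deriv (coefB 1)) (B2 e) e := by
  refine (hasDeriv_B1 he).congr_of_eventuallyEq ?_
  have : ∀ᶠ x in nhds e, 0 < 1 - x ^ 2 :=
    (by fun_prop : Continuous fun x : ℝ => 1 - x ^ 2).continuousAt.eventually (lt_mem_nhds he)
  exact this.mono fun x hx => (hasDeriv_B hx).deriv

lemma Ks3_pos {e : ℝ} (he : 0 < e) (he1 : e ≤ 1) : 0 < Ks 3 e := by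
  refine lt_of_lt_of_le ?_ (Ks3_lower he he1)
  have : e ^ 3 ≤ e ^ 1 := pow_le_pow_of_le_one he.le he1 (by norm_num)
  linarith

lemma Kc4_pos {e : ℝ} (he : 0 < e) (he1 : e ≤ 1) : 0 < Kc 4 e := by
  refine lt_of_lt_of_le ?_ (Kc4_lower e)
  nlinarith

lemma A2_pos {e : ℝ} (he : 0 < e) (he1 : e < 1) : 0 < A2 e := by
  have h1 := Ks3_pos he he1.le
  have h2 := Kc4_pos he he1.le
  have h3 := Ks5_le he he1.le
  have := mul_pos he h2
  unfold A2; linarith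

lemma one_sub_sq_pos {e : ℝ} (he : 0 < e) (he1 : e < 1) : 0 < 1 - e ^ 2 := by nlinarith

lemma B2_pos {e : ℝ} (he : 0 < e) (he1 : e < 1) : 0 < B2 e := by
  have h1 := Ks3_pos he he1.le
  have h2 := Kc4_pos he he1.le
  have h3 := Ks5_nonneg he he1.le
  have := Real.sqrt_pos.2 (one_sub_sq_pos he he1)
  unfold B2; positivity

lemma P_neg {e : ℝ} (he : 0 < e) (he1 : e < 1) : coefA 1 e + coefB 1 e < 0 := by
  have h1 := Ks1_lower he he1.le
  have h2 := mul_le_mul_of_nonneg_left (Kc2_lower e) he.le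
  have h3 := Ks3_upper he he1.le
  have h4 := mul_nonneg (Real.sqrt_nonneg (1 - e ^ 2)) (Ks3_pos he he1.le).le
  have : e ^ 3 ≤ e ^ 1 := pow_le_pow_of_le_one he.le he1.le (by norm_num)
  rw [coefA_eq, coefB_eq]
  simp only
  nlinarith

lemma M_neg {e : ℝ} (he : 0 < e) (he1 : e < 1) : coefA 1 e - coefB 1 e < 0 := by
  have h1 := Ks1_lower he he1.le
  have h2 := mul_le_mul_of_nonneg_left (Kc2_lower e) he.le
  have h3 := Ks3_upper he he1.le
  have h5 : Real.sqrt (1 - e ^ 2) ≤ 1 - e ^ 2 / 2 := by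
    rw [Real.sqrt_le_left (by nlinarith)]
    nlinarith [sq_nonneg (e ^ 2)]
  have h4 := mul_le_mul_of_nonneg_right h5 (Ks3_pos he he1.le).le
  have h6 := mul_le_mul_of_nonneg_left h3 (show 0 ≤ 2 - e ^ 2 / 2 by nlinarith)
  have h7 : e ^ 5 < e ^ 3 := pow_lt_pow_right_of_lt_one₀ he he1 (by norm_num)
  have h8 : 0 < e ^ 3 := by positivity
  rw [coefA_eq, coefB_eq]
  simp only
  nlinarith

lemma A1_inj {x y : ℝ} (hx : x ∈ Ioo (0:ℝ) 1) (hy : y ∈ Ioo (0:ℝ) 1) (h : A1 x = A1 y) : x = y := by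
  have : StrictMonoOn A1 (Ioo 0 1) := by
    apply strictMonoOn_of_deriv_pos (convex_Ioo 0 1)
    · exact fun e _ => (hasDeriv_A1 e).continuousAt.continuousWithinAt
    · intro e he
      rw [interior_Ioo] at he
      rw [(hasDeriv_A1 e).deriv]; exact A2_pos he.1 he.2
  exact this.injOn hx hy h

lemma B1_inj {x y : ℝ} (hx : x ∈ Ioo (0:ℝ) 1) (hy : y ∈ Ioo (0:ℝ) 1) (h : B1 x = B1 y) : x = y := by
  have : StrictMonoOn B1 (Ioo 0 1) := by
    apply strictMonoOn_of_deriv_pos (convex_Ioo 0 1)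
    · exact fun e he => (hasDeriv_B1 (one_sub_sq_pos he.1 he.2)).continuousAt.continuousWithinAt
    · intro e he
      rw [interior_Ioo] at he
      rw [(hasDeriv_B1 (one_sub_sq_pos he.1 he.2)).deriv]; exact B2_pos he.1 he.2
  exact this.injOn hx hy h

lemma exists_B1_zero : ∃ e ∈ Ioo (0:ℝ) 1, B1 e = 0 := by
  refine exists_hasDerivAt_eq_zero (f := coefB 1) zero_lt_one ?_ ?_ ?_
  · rw [coefB_eq]
    have : Continuous (Ks 3) := continuous_iff_continuousAt.2 fun x => (hasDeriv_Ks 3 x).continuousAt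
    exact Continuous.continuousOn (by fun_prop)
  · rw [coefB_eq]; simp [Ks_zero]
  · exact fun x hx => hasDeriv_B (one_sub_sq_pos hx.1 hx.2)

lemma cos_zeros_finite (c : ℝ) : {u : ℝ | Real.cos u = 0 ∧ |u| ≤ c}.Finite := by
  refine ((Set.finite_Icc (-(⌈c⌉ + 1)) (⌈c⌉ + 1)).image
    (fun k : ℤ => (2 * (k:ℝ) + 1) * π / 2)).subset ?_
  rintro u ⟨hu, hc⟩
  obtain ⟨k, hk⟩ := Real.cos_eq_zero_iff.1 hu
  refine ⟨k, ?_, hk.symm⟩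
  have h3 := Real.pi_gt_three
  have hb := abs_le.1 hc
  have hc' := Int.le_ceil c
  constructor
  · by_contra hlt
    push Not at hlt
    have : (k:ℝ) + 1 ≤ -(⌈c⌉ + 1) := by exact_mod_cast hlt
    have h0 : 0 ≤ c := (abs_nonneg u).trans hc
    nlinarith
  · by_contra hlt
    push Not at hlt
    have : (⌈c⌉:ℝ) + 1 + 1 ≤ k := by exact_mod_cast hlt
    have h0 : 0 ≤ c := (abs_nonneg u).trans hc
    nlinarith

lemma sin_pm {u : ℝ} (h : Real.cos u = 0) : Real.sin u = 1 ∨ Real.sin u = -1 := by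
  have := Real.sin_sq_add_cos_sq u
  rw [h] at this
  exact sq_eq_one_iff.1 (by linarith)

/-- For `m = 1`, `α² + β² ≠ 0` and `αβ sin ρ = 0`, the bifurcation system (B) for the
`(1:1)` resonance has a nonzero finite number of solutions, all of which are simple. -/
theorem stmt_15 (α β ρ : ℝ) (hαβ : α ^ 2 + β ^ 2 ≠ 0) (hρ : α * β * Real.sin ρ = 0)
    (σ τ : ℝ)
    (hσ1 : calE α β ρ * Real.cos σ = β * Real.cos ρ)
    (hσ2 : calE α β ρ * Real.sin σ = α + β * Real.sin ρ)
    (hτ1 : calF α β ρ * Real.cos τ = β * Real.cos ρ)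
    (hτ2 : calF α β ρ * Real.sin τ = α - β * Real.sin ρ) :
    (bifSolSet 1 α β ρ σ τ).Finite ∧ (bifSolSet 1 α β ρ σ τ).Nonempty ∧
      ∀ p ∈ bifSolSet 1 α β ρ σ τ, bifJac 1 α β ρ σ τ p.1 p.2.1 p.2.2 ≠ 0 := by 
  have hR : calF α β ρ = calE α β ρ := by
    unfold calE calF
    congr 1; linear_combination (-4) * hρ
  have hRpos : 0 < calE α β ρ := by
    unfold calE
    apply Real.sqrt_pos.2
    have : 0 < α ^ 2 + β ^ 2 := lt_of_le_of_ne (by positivity) (Ne.symm hαβ)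
    linear_combination this - 2 * hρ
  generalize hRR : calE α β ρ = R at *
  have facts : ∀ p ∈ bifSolSet 1 α β ρ σ τ, Real.cos (2 * p.2.2 + p.2.1 + τ) = 0 ∧
      Real.cos (2 * p.2.2 - p.2.1 + σ) = 0 ∧
      (A1 p.1 + B1 p.1) * Real.sin (2 * p.2.2 + p.2.1 + τ) +
      (A1 p.1 - B1 p.1) * Real.sin (2 * p.2.2 - p.2.1 + σ) = 0 := by
    rintro ⟨e, ℓ, g⟩ ⟨he, hl, hg, h1, h2, h3⟩
    simp only at he hl hg h1 h2 h3 ⊢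
    have hP := P_neg he.1 he.2
    have hM := M_neg he.1 he.2
    have hB := (hasDeriv_B (one_sub_sq_pos he.1 he.2)).deriv
    simp only [bifF1, bifF2, bifF3, hR, hRR, Nat.cast_one, one_mul, deriv_A, hB] at h1 h2 h3
    refine ⟨?_, ?_, ?_⟩
    · exact (mul_eq_zero.1 h1).resolve_left (mul_ne_zero hRpos.ne' hP.ne)
    · exact (mul_eq_zero.1 h2).resolve_left (mul_ne_zero hRpos.ne' hM.ne)
    · apply mul_left_cancel₀ hRpos.ne'
      linear_combination h3
  refine ⟨?_, ?_, ?_⟩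
  · have hfinE : {e : ℝ | e ∈ Ioo (0:ℝ) 1 ∧ (A1 e = 0 ∨ B1 e = 0)}.Finite := by
      have hA : {e : ℝ | e ∈ Ioo (0:ℝ) 1 ∧ A1 e = 0}.Finite :=
        Set.Subsingleton.finite fun x hx y hy => A1_inj hx.1 hy.1 (hx.2.trans hy.2.symm)
      have hB : {e : ℝ | e ∈ Ioo (0:ℝ) 1 ∧ B1 e = 0}.Finite :=
        Set.Subsingleton.finite fun x hx y hy => B1_inj hx.1 hy.1 (hx.2.trans hy.2.symm)
      refine (hA.union hB).subset ?_
      rintro x ⟨hx, h | h⟩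
      · exact Or.inl ⟨hx, h⟩
      · exact Or.inr ⟨hx, h⟩
    have hfin := hfinE.prod ((cos_zeros_finite (6 * π + |τ|)).prod (cos_zeros_finite (6 * π + |σ|)))
    refine Set.Finite.of_finite_image (f := fun p : ℝ × ℝ × ℝ =>
      (p.1, 2 * p.2.2 + p.2.1 + τ, 2 * p.2.2 - p.2.1 + σ)) (hfin.subset ?_) ?_
    · rintro _ ⟨p, hp, rfl⟩
      obtain ⟨hu, hv, h3⟩ := facts p hp
      obtain ⟨he, hl, hg, -⟩ := hp
      have hpi := Real.pi_pos
      refine ⟨⟨he, ?_⟩, ⟨hu, ?_⟩, ⟨hv, ?_⟩⟩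
      · rcases sin_pm hu with a | a <;> rcases sin_pm hv with b | b <;> rw [a, b] at h3
        · left; linarith
        · right; linarith
        · right; linarith
        · left; linarith
      · have := neg_abs_le τ
        have := le_abs_self τ
        simp only
        rw [abs_le]; constructor <;> linarith [hl.1, hl.2, hg.1, hg.2]
      · have := neg_abs_le σ
        have := le_abs_self σ
        simp only
        rw [abs_le]; constructor <;> linarith [hl.1, hl.2, hg.1, hg.2]
    · rintro ⟨e, l, g⟩ - ⟨e', l', g'⟩ - h
      simp only [Prod.mk.injEq] at h ⊢
      obtain ⟨h1, h2, h3⟩ := h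
      refine ⟨h1, ?_, ?_⟩ <;> linarith
  · obtain ⟨e, he, hB0⟩ := exists_B1_zero
    have hper : (0:ℝ) < 2 * π := by positivity
    obtain ⟨l, hl, j, hj⟩ : ∃ l ∈ Ico (0:ℝ) (2 * π), ∃ j : ℤ,
        l = (π + σ - τ) / 2 - j * (2 * π) := by
      refine ⟨toIcoMod hper 0 ((π + σ - τ) / 2), ?_, toIcoDiv hper 0 ((π + σ - τ) / 2), ?_⟩
      · simpa using toIcoMod_mem_Ico hper 0 ((π + σ - τ) / 2)
      · rw [toIcoMod, zsmul_eq_mul]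
    obtain ⟨g, hg, k, hk⟩ : ∃ g ∈ Ico (0:ℝ) (2 * π), ∃ k : ℤ,
        g = -(τ + σ) / 4 - k * (2 * π) := by
      refine ⟨toIcoMod hper 0 (-(τ + σ) / 4), ?_, toIcoDiv hper 0 (-(τ + σ) / 4), ?_⟩
      · simpa using toIcoMod_mem_Ico hper 0 (-(τ + σ) / 4)
      · rw [toIcoMod, zsmul_eq_mul]
    have hu : 2 * g + l + τ = π / 2 - ((2 * k + j : ℤ) : ℝ) * (2 * π) := by
      rw [hj, hk]; push_cast; ring
    have hv : 2 * g - l + σ = -(π / 2) - ((2 * k - j : ℤ) : ℝ) * (2 * π) := by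
      rw [hj, hk]; push_cast; ring
    have hB := (hasDeriv_B (one_sub_sq_pos he.1 he.2)).deriv
    refine ⟨(e, l, g), he, hl, hg, ?_, ?_, ?_⟩
    · simp only [bifF1, Nat.cast_one, one_mul, hu, Real.cos_sub_int_mul_two_pi]; simp
    · simp only [bifF2, Nat.cast_one, one_mul, hv, Real.cos_sub_int_mul_two_pi]; simp
    · simp only [bifF3, Nat.cast_one, one_mul, hu, hv, Real.sin_sub_int_mul_two_pi, hR, hRR,
        deriv_A, hB, hB0]; simp
  · intro p hp
    obtain ⟨hu, hv, -⟩ := facts p hp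
    obtain ⟨e, l, g⟩ := p
    have he : e ∈ Ioo (0:ℝ) 1 := hp.1
    simp only at hu hv ⊢
    have hpos := one_sub_sq_pos he.1 he.2
    have hP := P_neg he.1 he.2
    have hM := M_neg he.1 he.2
    have hA2 := A2_pos he.1 he.2
    have hB2 := B2_pos he.1 he.2
    have dA := hasDeriv_A e
    have dB := hasDeriv_B hpos
    have ddA : HasDerivAt (deriv (coefA 1)) (A2 e) e := by rw [deriv_A]; exact hasDeriv_A1 e
    have ddB := hasDeriv_dB hpos
    have ul : HasDerivAt (fun x : ℝ => 2 * g + x + τ) 1 l :=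
      ((hasDerivAt_id l).const_add (2 * g)).add_const τ
    have ug : HasDerivAt (fun x : ℝ => 2 * x + l + τ) 2 g := by
      simpa using (((hasDerivAt_id g).const_mul 2).add_const l).add_const τ
    have vl : HasDerivAt (fun x : ℝ => 2 * g - x + σ) (-1) l :=
      ((hasDerivAt_id l).const_sub (2 * g)).add_const σ
    have vg : HasDerivAt (fun x : ℝ => 2 * x - l + σ) 2 g := by
      simpa using (((hasDerivAt_id g).const_mul 2).sub_const l).add_const σ
    unfold bifJac bifF1 bifF2 bifF3
    simp only [hR, hRR, Nat.cast_one, one_mul]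
    rw [(((dA.fun_add dB).const_mul R).mul_const (Real.cos (2 * g + l + τ))).deriv,
      (ul.cos.const_mul (R * (coefA 1 e + coefB 1 e))).deriv,
      (ug.cos.const_mul (R * (coefA 1 e + coefB 1 e))).deriv,
      (((dA.fun_sub dB).const_mul R).mul_const (Real.cos (2 * g - l + σ))).deriv,
      (vl.cos.const_mul (R * (coefA 1 e - coefB 1 e))).deriv,
      (vg.cos.const_mul (R * (coefA 1 e - coefB 1 e))).deriv,
      ((((ddA.fun_add ddB).mul_const R).mul_const (Real.sin (2 * g + l + τ))).fun_add
        (((ddA.fun_sub ddB).mul_const R).mul_const (Real.sin (2 * g - l + σ)))).deriv,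
      ((ul.sin.const_mul ((deriv (coefA 1) e + deriv (coefB 1) e) * R)).fun_add
        (vl.sin.const_mul ((deriv (coefA 1) e - deriv (coefB 1) e) * R))).deriv,
      ((ug.sin.const_mul ((deriv (coefA 1) e + deriv (coefB 1) e) * R)).fun_add
        (vg.sin.const_mul ((deriv (coefA 1) e - deriv (coefB 1) e) * R))).deriv]
    rw [Matrix.det_fin_three]
    simp only [Matrix.of_apply, Matrix.cons_val', Matrix.cons_val_zero, Matrix.cons_val_one,
      Matrix.cons_val, hu, hv]
    have hPM : (coefA 1 e + coefB 1 e) * (coefA 1 e - coefB 1 e) ≠ 0 := mul_ne_zero hP.ne hM.ne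
    have hR3 : R ^ 3 ≠ 0 := pow_ne_zero _ hRpos.ne'
    have hAne := mul_ne_zero (mul_ne_zero hR3 hPM) hA2.ne'
    have hBne := mul_ne_zero (mul_ne_zero hR3 hPM) hB2.ne'
    rcases sin_pm hu with a | a <;> rcases sin_pm hv with b | b <;> rw [a, b] <;> intro h
    · apply hAne; linear_combination (1 / 8) * h
    · apply hBne; linear_combination (-1 / 8) * h
    · apply hBne; linear_combination (1 / 8) * h
    · apply hAne; linear_combination (-1 / 8) * h
end

section
/- Fix e ∈ (0,1). For each real ℓ let û(ℓ) be the unique real solution of Kepler's equation û − e sin û = ℓ, and define r̃(ℓ) := 1 − e cos û(ℓ), c(ℓ) := (cos û(ℓ) − e)/r̃(ℓ) and s(ℓ) := √(1−e²)·sin û(ℓ)/r̃(ℓ) (the cosine and sine of the true anomaly). For g ∈ ℝ set C(ℓ, g) := r̃(ℓ)²[(2c(ℓ)² − 1)cos 2g − 2c(ℓ)s(ℓ) sin 2g] and S(ℓ, g) := r̃(ℓ)²[2c(ℓ)s(ℓ) cos 2g + (2c(ℓ)² − 1) sin 2g]. Then for all relatively prime positive integers m and n with n ≥ 2, and all real numbers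 g, c₁, c₂, α, β, the integral ∫₀^{2π} [α·C(nσ, g)·cos(mσ − c₁) + β·S(nσ, g)·cos(mσ − c₂)] dσ equals zero. -/
open Real

theorem aux_int (f : ℝ → ℝ) (hf : Continuous f) (hp : ∀ x, f (x + 2 * π) = f x)
    (m n : ℕ) (hn : 2 ≤ n) (hmn : Nat.Coprime m n) (a : ℝ) :
    ∫ σ in (0:ℝ)..(2 * π), f (n * σ) * Real.cos (m * σ - a) = 0 := by
  have hn0 : (n : ℝ) ≠ 0 := by positivity
  obtain ⟨θ, hθ⟩ : ∃ θ : ℝ, θ = m * (2 * π / n) := ⟨_, rfl⟩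
  have hper : Function.Periodic f (2 * π) := hp
  have shift : ∀ b : ℝ, ∫ σ in (0:ℝ)..(2 * π), f (n * σ) * Real.cos (m * σ - b)
      = ∫ σ in (0:ℝ)..(2 * π), f (n * σ) * Real.cos (m * σ - b + θ) := by
    intro b
    have hP : Function.Periodic (fun σ : ℝ => f (n * σ) * Real.cos (m * σ - b)) (2 * π) := by
      intro x
      have h1 : f (n * (x + 2 * π)) = f (n * x) := by
        rw [mul_add]; exact (hper.nat_mul n) _
      have h2 : Real.cos (m * (x + 2 * π) - b) = Real.cos (m * x - b) := by
        rw [show (m:ℝ) * (x + 2 * π) - b = (m * x - b) + m * (2 * π) by ring]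
        exact Real.cos_add_nat_mul_two_pi _ _
      simp only [h1, h2]
    have h := hP.intervalIntegral_add_eq 0 (2 * π / n)
    rw [zero_add, add_comm (2 * π / (n:ℝ)) (2 * π)] at h
    rw [h]
    have h3 := intervalIntegral.integral_comp_add_right (a := 0) (b := 2 * π)
      (fun σ : ℝ => f (n * σ) * Real.cos (m * σ - b)) (2 * π / n)
    rw [zero_add] at h3
    rw [← h3]
    congr 1
    ext x
    have h1 : f (n * (x + 2 * π / n)) = f (n * x) := by
      rw [mul_add, mul_div_cancel₀ _ hn0]; exact hp _
    rw [h1, hθ]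
    congr 2
    ring
  have e1 := shift a
  have e2 := shift (a + θ)
  simp only [show ∀ σ : ℝ, m * σ - (a + θ) + θ = m * σ - a from fun σ => by ring] at e2
  have e3 : (∫ σ in (0:ℝ)..(2 * π), f (n * σ) * Real.cos (m * σ - a + θ))
      + (∫ σ in (0:ℝ)..(2 * π), f (n * σ) * Real.cos (m * σ - (a + θ)))
      = 2 * Real.cos θ * ∫ σ in (0:ℝ)..(2 * π), f (n * σ) * Real.cos (m * σ - a) := by
    rw [← intervalIntegral.integral_add, ← intervalIntegral.integral_const_mul]
    · congr 1
      ext x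
      rw [show (m:ℝ) * x - (a + θ) = (m * x - a) - θ by ring, Real.cos_add, Real.cos_sub _ θ]
      ring
    · exact Continuous.intervalIntegrable (by fun_prop) _ _
    · exact Continuous.intervalIntegrable (by fun_prop) _ _
  rw [← e1, e2] at e3
  have hc : Real.cos θ ≠ 1 := by
    intro h
    obtain ⟨k, hk⟩ := (Real.cos_eq_one_iff _).1 h
    rw [hθ] at hk
    have hpi := Real.pi_pos
    have h4 : (k : ℝ) * n = m := by
      field_simp at hk
      nlinarith
    have h5 : k * (n : ℤ) = m := by exact_mod_cast h4
    have h6 : n ∣ m := by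
      have : (n : ℤ) ∣ m := ⟨k, by rw [← h5]; ring⟩
      exact_mod_cast this
    have := Nat.eq_one_of_dvd_coprimes hmn h6 dvd_rfl
    omega
  have : (1 - Real.cos θ) * ∫ σ in (0:ℝ)..(2 * π), f (n * σ) * Real.cos (m * σ - a) = 0 := by
    linarith
  rcases mul_eq_zero.1 this with h | h
  · exact absurd (by linarith) hc
  · exact h

theorem aux_sin (x y : ℝ) : |Real.sin x - Real.sin y| ≤ |x - y| := by
  have h := Real.lipschitzWith_sin.dist_le_mul x y
  simpa [Real.dist_eq] using h

/-- Fix `e ∈ (0,1)` and let `û(ℓ)` solve Kepler's equation `û − e sin û = ℓ`. With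
`r̃ = 1 − e cos û`, `c = (cos û − e)/r̃`, `s = √(1−e²) sin û/r̃` (cosine and sine of the
true anomaly), and the quadrupole functions
`C(ℓ,g) = r̃²[(2c²−1)cos 2g − 2cs sin 2g]`, `S(ℓ,g) = r̃²[2cs cos 2g + (2c²−1)sin 2g]`,
the resonance integral for an `(m:n)` resonance with `n ≥ 2`, `gcd(m,n) = 1` vanishes. -/
theorem stmt_19 (e : ℝ) (he : e ∈ Set.Ioo (0:ℝ) 1)
    (u : ℝ → ℝ) (hu : ∀ ℓ, u ℓ - e * Real.sin (u ℓ) = ℓ)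
    (rt c s : ℝ → ℝ)
    (hrt : ∀ ℓ, rt ℓ = 1 - e * Real.cos (u ℓ))
    (hc : ∀ ℓ, c ℓ = (Real.cos (u ℓ) - e) / rt ℓ)
    (hs : ∀ ℓ, s ℓ = Real.sqrt (1 - e ^ 2) * Real.sin (u ℓ) / rt ℓ)
    (C S : ℝ → ℝ → ℝ)
    (hC : ∀ ℓ g, C ℓ g = rt ℓ ^ 2 *
      ((2 * c ℓ ^ 2 - 1) * Real.cos (2 * g) - 2 * c ℓ * s ℓ * Real.sin (2 * g)))
    (hS : ∀ ℓ g, S ℓ g = rt ℓ ^ 2 *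
      (2 * c ℓ * s ℓ * Real.cos (2 * g) + (2 * c ℓ ^ 2 - 1) * Real.sin (2 * g)))
    (m n : ℕ) (hm : 0 < m) (hn : 2 ≤ n) (hmn : Nat.Coprime m n)
    (g c₁ c₂ α β : ℝ) :
    ∫ σ in (0:ℝ)..(2 * π),
      (α * C (n * σ) g * Real.cos (m * σ - c₁) +
       β * S (n * σ) g * Real.cos (m * σ - c₂)) = 0 := by 
  obtain ⟨he0, he1⟩ := he
  have key : ∀ x y : ℝ, (1 - e) * |x - y| ≤ |(x - e * Real.sin x) - (y - e * Real.sin y)| := by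
    intro x y
    have h1 := aux_sin x y
    have h2 := abs_sub_abs_le_abs_sub (x - y) (e * (Real.sin x - Real.sin y))
    rw [abs_mul, abs_of_pos he0] at h2
    rw [show (x - e * Real.sin x) - (y - e * Real.sin y)
      = (x - y) - e * (Real.sin x - Real.sin y) by ring]
    nlinarith
  have hper : ∀ x, u (x + 2 * π) = u x + 2 * π := by
    intro x
    have h := key (u (x + 2 * π)) (u x + 2 * π)
    rw [hu, Real.sin_add_two_pi] at h
    have h3 := hu x
    rw [show x + 2 * π - (u x + 2 * π - e * Real.sin (u x)) = 0 by linarith, abs_zero] at h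
    have h4 : |u (x + 2 * π) - (u x + 2 * π)| ≤ 0 := by
      by_contra! hh
      have := mul_pos (sub_pos.2 he1) hh
      linarith
    exact sub_eq_zero.1 (abs_nonpos_iff.1 h4)
  have hcont : Continuous u := by
    have : LipschitzWith (Real.toNNReal (1 / (1 - e))) u := by
      apply LipschitzWith.of_dist_le_mul
      intro x y
      have h := key (u x) (u y)
      rw [hu, hu] at h
      have h1 : 0 < 1 - e := sub_pos.2 he1
      rw [Real.coe_toNNReal _ (by positivity), Real.dist_eq, Real.dist_eq, one_div,
        inv_mul_eq_div, le_div_iff₀ h1]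
      linarith
    exact this.continuous
  have hrt' : rt = fun ℓ => 1 - e * Real.cos (u ℓ) := funext hrt
  have hrc : Continuous rt := by rw [hrt']; fun_prop
  have hr0 : ∀ x, rt x ≠ 0 := by
    intro x
    rw [hrt]
    have := Real.cos_le_one (u x)
    nlinarith
  have hcc : Continuous c := by
    rw [funext hc]
    exact Continuous.div (by fun_prop) hrc hr0
  have hsc : Continuous s := by
    rw [funext hs]
    exact Continuous.div (by fun_prop) hrc hr0
  have pr : ∀ x, rt (x + 2 * π) = rt x := by
    intro x; rw [hrt, hrt, hper, Real.cos_add_two_pi]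
  have pc : ∀ x, c (x + 2 * π) = c x := by
    intro x; rw [hc, hc, pr, hper, Real.cos_add_two_pi]
  have ps : ∀ x, s (x + 2 * π) = s x := by
    intro x; rw [hs, hs, pr, hper, Real.sin_add_two_pi]
  have hCc : Continuous (fun x => C x g) := by
    simp only [hC]; fun_prop
  have hSc : Continuous (fun x => S x g) := by
    simp only [hS]; fun_prop
  have I1 := aux_int (fun x => C x g) hCc
    (by intro x; simp only [hC, pr, pc, ps]) m n hn hmn c₁
  have I2 := aux_int (fun x => S x g) hSc
    (by intro x; simp only [hS, pr, pc, ps]) m n hn hmn c₂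
  have hC2 : Continuous (fun σ : ℝ => C (n * σ) g) :=
    hCc.comp (g := fun x => C x g) (f := fun σ : ℝ => n * σ) (by fun_prop)
  have hS2 : Continuous (fun σ : ℝ => S (n * σ) g) :=
    hSc.comp (g := fun x => S x g) (f := fun σ : ℝ => n * σ) (by fun_prop)
  simp only [mul_assoc α, mul_assoc β]
  rw [intervalIntegral.integral_add, intervalIntegral.integral_const_mul,
    intervalIntegral.integral_const_mul]
  · skip
    rw [I1, I2]; ring
  · exact Continuous.intervalIntegrable (by fun_prop) _ _
  · exact Continuous.intervalIntegrable (by fun_prop) _ _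
end
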